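/- Every 3-uniform linear hypergraph on n vertices containing no Berge cycle of length 2k+1 (k ≥ 2) has at most 2k·n^{1+1/k} + 9kn hyperedges. -/

import Mathlib

/-- The hypergraph `H` contains a Berge cycle of length `ℓ`. -/
def HasBergeCycle {V : Type*} (H : Finset (Finset V)) (ℓ : ℕ) : Prop :=
  ∃ (f : Fin ℓ → Finset V) (v : Fin ℓ → V),
    Function.Injective f ∧ Function.Injective v ∧
    (∀ i, f i ∈ H) ∧ ∀ i : Fin ℓ, v i ∈ f i ∧ v ⟨(↑i + 1) % ℓ, Nat.mod_lt _ i.pos⟩ ∈ f i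

/-- `Links R u l w` says that the list `l` of pairs (edge, next vertex) describes a walk from `u`
to `w` each of whose steps satisfies `R`. -/
def Links {V ε : Type*} (R : V → ε → V → Prop) : V → List (ε × V) → V → Prop
  | u, [], w => u = w
  | u, p :: l, w => R u p.1 p.2 ∧ Links R p.2 l w

/-- One step of a Berge path from `u` to `v` through the hyperedge `E` of `H`. -/
def BergeLink {V : Type*} (H : Finset (Finset V)) (u : V) (E : Finset V) (v : V) : Prop :=
  E ∈ H ∧ u ∈ E ∧ v ∈ E

/-- One step from `u` to `v` along the edge `e` of the graph `G` with endpoint map `ends`. -/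
def EdgeLink {V ι : Type*} [DecidableEq V] (G : Finset ι) (ends : ι → Finset V)
    (u : V) (e : ι) (v : V) : Prop :=
  e ∈ G ∧ ends e = {u, v} ∧ u ≠ v

theorem Links.append {V ε : Type*} {R : V → ε → V → Prop} {u v w : V} {l l' : List (ε × V)}
    (h : Links R u l v) (h' : Links R v l' w) : Links R u (l ++ l') w := by
  induction l generalizing u with
  | nil => cases h; exact h'
  | cons p l ih => exact ⟨h.1, ih h.2⟩

theorem Links.imp {V ε : Type*} {R R' : V → ε → V → Prop} (hR : ∀ u e v, R u e v → R' u e v)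
    {u w : V} {l : List (ε × V)} (h : Links R u l w) : Links R' u l w := by
  induction l generalizing u with
  | nil => exact h
  | cons p l ih => exact ⟨hR _ _ _ h.1, ih h.2⟩

theorem Links.getElem_succ {V ε : Type*} {R : V → ε → V → Prop} {u w : V} {l : List (ε × V)}
    (h : Links R u l w) (i : ℕ) (hi : i + 1 < l.length) :
    R l[i].2 l[i + 1].1 l[i + 1].2 := by
  induction l generalizing u i with
  | nil => simp at hi
  | cons p l ih =>
    cases i with
    | zero =>
      cases l with
      | nil => simp at hi
      | cons q l => exact h.2.1
    | succ i => exact ih h.2 i (by simpa using hi)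

theorem Links.getElem_last {V ε : Type*} {R : V → ε → V → Prop} {u w : V} {l : List (ε × V)}
    (h : Links R u l w) (hl : 0 < l.length) : l[l.length - 1].2 = w := by
  induction l generalizing u with
  | nil => simp at hl
  | cons p l ih =>
    cases l with
    | nil => exact h.2
    | cons q l => simpa using ih h.2 (by simp)

theorem Links.getElem_zero {V ε : Type*} {R : V → ε → V → Prop} {u w : V} {l : List (ε × V)}
    (h : Links R u l w) (hl : 0 < l.length) : R u l[0].1 l[0].2 := by
  cases l with
  | nil => simp at hl
  | cons p l => exact h.1

theorem Links.hasBergeCycle {V : Type*} {H : Finset (Finset V)} {u : V}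
    {l : List (Finset V × V)} (h : Links (BergeLink H) u l u)
    (he : (l.map Prod.fst).Nodup) (hv : (l.map Prod.snd).Nodup) :
    HasBergeCycle H l.length := by
  have key : ∀ i : Fin l.length,
      BergeLink H (l[i.1]).2 (l[(i.1 + 1) % l.length]'(Nat.mod_lt _ i.pos)).1
        (l[(i.1 + 1) % l.length]'(Nat.mod_lt _ i.pos)).2 := by
    intro i
    rcases Nat.lt_or_ge (i.1 + 1) l.length with hi | hi
    · simp only [Nat.mod_eq_of_lt hi]
      exact h.getElem_succ i.1 hi
    · have h1 : i.1 + 1 = l.length := by omega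
      have h2 : i.1 = l.length - 1 := by omega
      have := h.getElem_zero i.pos
      rw [← h.getElem_last i.pos] at this
      have h3 : (i.1 + 1) % l.length = 0 := by rw [h1, Nat.mod_self]
      simp only [h3]
      simpa only [h2] using this
  have modinj : ∀ i j : Fin l.length, (i.1 + 1) % l.length = (j.1 + 1) % l.length → i = j := by
    intro i j hij
    have hi := i.2
    have hj := j.2
    apply Fin.ext
    rcases Nat.lt_or_ge (i.1 + 1) l.length with hi | hi <;>
      rcases Nat.lt_or_ge (j.1 + 1) l.length with hj | hj
    · rw [Nat.mod_eq_of_lt hi, Nat.mod_eq_of_lt hj] at hij; omega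
    · rw [Nat.mod_eq_of_lt hi, show j.1 + 1 = l.length by omega, Nat.mod_self] at hij; omega
    · rw [Nat.mod_eq_of_lt hj, show i.1 + 1 = l.length by omega, Nat.mod_self] at hij; omega
    · omega
  refine ⟨fun i => (l[(i.1 + 1) % l.length]'(Nat.mod_lt _ i.pos)).1, fun i => (l[i.1]).2,
    ?_, ?_, fun i => (key i).1, fun i => ⟨(key i).2.1, (key i).2.2⟩⟩
  · intro i j hij
    apply modinj
    refine (List.Nodup.getElem_inj_iff he (hi := ?_) (hj := ?_)).1 ?_
    · simpa using Nat.mod_lt _ i.pos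
    · simpa using Nat.mod_lt _ i.pos
    · simpa using hij
  · intro i j hij
    apply Fin.ext
    refine (List.Nodup.getElem_inj_iff hv (hi := ?_) (hj := ?_)).1 ?_
    · simp
    · simp
    · simpa using hij

theorem Links.mem_of_edgeLink {V ι : Type*} [DecidableEq V] {G : Finset ι} {ends : ι → Finset V}
    {u w : V} {l : List (ι × V)} (h : Links (EdgeLink G ends) u l w) {e : ι}
    (he : e ∈ l.map Prod.fst) : e ∈ G ∧ ∀ v ∈ ends e, v ∈ u :: l.map Prod.snd := by
  induction l generalizing u with
  | nil => simp at he
  | cons p l ih =>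
    rw [List.map_cons, List.mem_cons] at he
    rcases he with rfl | he
    · refine ⟨h.1.1, fun v hv => ?_⟩
      rw [h.1.2.1] at hv
      simp only [Finset.mem_insert, Finset.mem_singleton] at hv
      rcases hv with rfl | rfl <;> simp
    · obtain ⟨h1, h2⟩ := ih h.2 he
      exact ⟨h1, fun v hv => List.mem_cons_of_mem _ (h2 v hv)⟩

theorem Links.nodup_fst_of_edgeLink {V ι : Type*} [DecidableEq V] {G : Finset ι}
    {ends : ι → Finset V} {u w : V} {l : List (ι × V)} (h : Links (EdgeLink G ends) u l w)
    (hv : (u :: l.map Prod.snd).Nodup) : (l.map Prod.fst).Nodup := by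
  induction l generalizing u with
  | nil => simp
  | cons p l ih =>
    rw [List.map_cons, List.nodup_cons] at hv
    rw [List.map_cons, List.nodup_cons]
    refine ⟨fun hp => hv.1 ?_, ih h.2 hv.2⟩
    refine (h.2.mem_of_edgeLink hp).2 u ?_
    rw [h.1.2.1]; simp

theorem Links.end_mem {V ε : Type*} {R : V → ε → V → Prop} {u w : V} {l : List (ε × V)}
    (h : Links R u l w) : w ∈ u :: l.map Prod.snd := by
  induction l generalizing u with
  | nil => cases h; simp
  | cons p l ih => exact List.mem_cons_of_mem _ (ih h.2)

/-- In a graph all of whose non-isolated vertices have degree at least `N`, paths can be built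
greedily. -/
theorem exists_links_avoiding {V ι : Type*} [DecidableEq V] [DecidableEq ι] {G : Finset ι}
    {ends : ι → Finset V} {N : ℕ} (hinj : Set.InjOn ends G) (h2 : ∀ e ∈ G, (ends e).card = 2)
    (hdeg : ∀ e ∈ G, ∀ v ∈ ends e, N ≤ (G.filter (fun e' => v ∈ ends e')).card)
    (m : ℕ) (X : Finset V) (v : V) (hv : ∃ e ∈ G, v ∈ ends e) (hX : X.card + m ≤ N) (hvX : v ∉ X) :
    ∃ l w, Links (EdgeLink G ends) v l w ∧ l.length = m ∧ (v :: l.map Prod.snd).Nodup ∧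
      ∀ y ∈ v :: l.map Prod.snd, y ∉ X := by
  induction m generalizing X v with
  | zero => exact ⟨[], v, rfl, rfl, by simp, by simpa using hvX⟩
  | succ m ih =>
    have step : ∃ e ∈ G, ∃ u, ends e = {v, u} ∧ v ≠ u ∧ u ∉ X := by
      by_contra hcon
      push Not at hcon
      obtain ⟨e₀, he₀, hve₀⟩ := hv
      have hd := hdeg e₀ he₀ v hve₀
      have hother : ∀ e ∈ G.filter (fun e' => v ∈ ends e'), ∃ u ∈ X, ends e = {v, u} := by
        intro e he
        rw [Finset.mem_filter] at he
        obtain ⟨a, b, hab, hE⟩ := Finset.card_eq_two.1 (h2 e he.1)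
        have hm := he.2
        rw [hE] at hm
        simp only [Finset.mem_insert, Finset.mem_singleton] at hm
        rcases hm with rfl | rfl
        · exact ⟨b, hcon e he.1 b hE hab, hE⟩
        · rw [Finset.pair_comm] at hE
          exact ⟨a, hcon e he.1 a hE hab.symm, hE⟩
      have : Nonempty V := ⟨v⟩
      choose! o ho using hother
      have hcard : (G.filter (fun e' => v ∈ ends e')).card ≤ X.card := by
        refine Finset.card_le_card_of_injOn o (fun e he => (ho e he).1) ?_
        intro e he e' he' hee
        refine hinj (Finset.mem_filter.1 he).1 (Finset.mem_filter.1 he').1 ?_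
        rw [(ho e he).2, (ho e' he').2, hee]
      omega
    obtain ⟨e, he, u, hE, hvu, huX⟩ := step
    obtain ⟨l, w, hl, hlen, hnd, hav⟩ := ih (insert v X) u ⟨e, he, by simp [hE]⟩
      (by rw [Finset.card_insert_of_notMem hvX]; omega)
      (by simp [hvu.symm, huX])
    refine ⟨(e, u) :: l, w, ⟨⟨he, hE, hvu⟩, hl⟩, by simp [hlen], ?_, ?_⟩
    · rw [List.map_cons, List.nodup_cons]
      exact ⟨fun hm => hav v hm (by simp), hnd⟩
    · intro y hy
      rw [List.map_cons, List.mem_cons] at hy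
      rcases hy with rfl | hy
      · exact hvX
      · exact fun hyX => hav y hy (Finset.mem_insert_of_mem hyX)

/-- If vertices at distance two are always related, then the end of a walk is related to its first
or second vertex, according to parity. -/
theorem Links.alternating {V ι : Type*} [DecidableEq V] {G : Finset ι} {ends : ι → Finset V}
    {r : V → V → Prop} (hr : ∀ u, r u u) (ht : ∀ u v w, r u v → r v w → r u w)
    (hmono : ∀ u e v e' w, EdgeLink G ends u e v → EdgeLink G ends v e' w → r w u)
    {u v w : V} {e : ι} {l : List (ι × V)} (h0 : EdgeLink G ends u e v)
    (h : Links (EdgeLink G ends) v l w) :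
    (Even l.length → r w v) ∧ (Odd l.length → r w u) := by
  induction l generalizing u v e with
  | nil => cases h; exact ⟨fun _ => hr _, fun h => by simp at h⟩
  | cons p l ih =>
    obtain ⟨h1, h2⟩ := ih h.1 h.2
    refine ⟨fun hev => h2 ?_, fun hodd => ht _ _ _ (h1 ?_) (hmono _ _ _ _ _ h0 h.1)⟩
    · rw [List.length_cons] at hev
      exact Nat.not_even_iff_odd.1 (fun hh => (Nat.even_add_one.1 hev) hh)
    · rw [List.length_cons] at hodd
      by_contra hh
      exact Nat.not_even_iff_odd.2 hodd (Nat.even_add_one.2 hh)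

/-- A family of more than `c` times as many edges as vertices has a nonempty subfamily in which
every covered vertex has degree larger than `c`. -/
theorem exists_subset_min_degree {V ι : Type*} [DecidableEq V] [DecidableEq ι] (ends : ι → Finset V)
    (c : ℝ) (hc : 0 ≤ c) (S : Finset V) (F : Finset ι) (hS : ∀ e ∈ F, ends e ⊆ S)
    (hF : c * S.card < F.card) :
    ∃ G ⊆ F, G.Nonempty ∧
      ∀ e ∈ G, ∀ v ∈ ends e, c < (G.filter (fun e' => v ∈ ends e')).card := by
  induction hn : S.card generalizing S F with
  | zero =>
    refine ⟨F, subset_rfl, ?_, ?_⟩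
    · rw [← Finset.card_pos]
      rw [hn] at hF
      exact_mod_cast (by simpa using hF : (0 : ℝ) < F.card)
    · intro e he v hv
      rw [Finset.card_eq_zero] at hn
      have := hS e he hv
      simp [hn] at this
  | succ n ih =>
    by_cases hall : ∀ e ∈ F, ∀ v ∈ ends e, c < (F.filter (fun e' => v ∈ ends e')).card
    · refine ⟨F, subset_rfl, ?_, hall⟩
      rw [← Finset.card_pos]
      have : (0 : ℝ) ≤ c * S.card := by positivity
      exact_mod_cast lt_of_le_of_lt this hF
    · push Not at hall
      obtain ⟨e, he, v, hv, hdeg⟩ := hall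
      have hvS : v ∈ S := hS e he hv
      have hcard : (F.filter (fun e' => v ∈ ends e')).card
          + (F.filter (fun e' => ¬ v ∈ ends e')).card = F.card :=
        Finset.card_filter_add_card_filter_not _
      have hSc : (S.erase v).card + 1 = S.card := Finset.card_erase_add_one hvS
      obtain ⟨G, hG, hne, hdegG⟩ := ih (S.erase v) (F.filter (fun e' => ¬ v ∈ ends e'))
        (by
          intro e' he' y hy
          rw [Finset.mem_filter] at he'
          refine Finset.mem_erase.2 ⟨?_, hS e' he'.1 hy⟩
          rintro rfl
          exact he'.2 hy)
        (by
          have h1 : ((F.filter (fun e' => v ∈ ends e')).card : ℝ)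
            + (F.filter (fun e' => ¬ v ∈ ends e')).card = F.card := by exact_mod_cast hcard
          have h2 : ((S.erase v).card : ℝ) + 1 = S.card := by exact_mod_cast hSc
          rw [← h2] at hF
          nlinarith)
        (by omega)
      exact ⟨G, hG.trans (Finset.filter_subset _ _), hne, hdegG⟩

/-- A search tree of depth `k` in the hypergraph `H`: each vertex `v` has a level, and each vertex
of level between `1` and `k` has a parent one level below it, reached through the hyperedge
`edge v`. -/
structure BergeTree {V : Type*} (H : Finset (Finset V)) (k : ℕ) where
  lev : V → ℕ
  par : V → V
  edge : V → Finset V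
  lev_le : ∀ E ∈ H, ∀ u ∈ E, ∀ v ∈ E, lev u ≤ lev v + 1
  root_unique : ∀ u v, lev u = 0 → lev v = 0 → u = v
  edge_mem : ∀ v, 0 < lev v → lev v ≤ k → edge v ∈ H
  mem_edge : ∀ v, 0 < lev v → lev v ≤ k → v ∈ edge v
  par_mem_edge : ∀ v, 0 < lev v → lev v ≤ k → par v ∈ edge v
  lev_par : ∀ v, 0 < lev v → lev v ≤ k → lev (par v) + 1 = lev v

open Classical in
/-- The tree distance of two vertices of level `i`: `2 * j` if their ancestral lines meet in a
vertex `j` levels below, and `2 * j - 1` if they already share the hyperedge leading there. -/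
noncomputable def BergeTree.treeDist {V : Type*} {H : Finset (Finset V)} {k : ℕ}
    (T : BergeTree H k) : ℕ → V → V → ℕ
  | 0, _, _ => 0
  | i + 1, u, v =>
    if u = v then 0
    else if T.edge u = T.edge v ∧ T.par u = T.par v then 1
    else T.treeDist i (T.par u) (T.par v) + 2

namespace BergeTree

section Basic

variable {V : Type*} {H : Finset (Finset V)} {k : ℕ} (T : BergeTree H k)

theorem treeDist_self (i : ℕ) (u : V) : T.treeDist i u u = 0 := by
  cases i <;> simp [treeDist]

theorem treeDist_comm (i : ℕ) (u v : V) : T.treeDist i u v = T.treeDist i v u := by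
  induction i generalizing u v with
  | zero => rfl
  | succ i ih =>
    simp only [treeDist, ih (T.par u) (T.par v)]
    grind

theorem treeDist_le (i : ℕ) (u v : V) : T.treeDist i u v ≤ 2 * i := by
  induction i generalizing u v with
  | zero => simp [treeDist]
  | succ i ih =>
    have := ih (T.par u) (T.par v)
    simp only [treeDist]
    split_ifs <;> omega

theorem treeDist_par (i : ℕ) (u v : V) :
    T.treeDist i (T.par u) (T.par v) = T.treeDist (i + 1) u v - 2 := by
  simp only [treeDist]
  split_ifs with h1 h2
  · rw [h1, treeDist_self]
  · rw [h2.2, treeDist_self]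
  · omega

theorem treeDist_ultrametric (i : ℕ) (u v w : V) :
    T.treeDist i u w ≤ max (T.treeDist i u v) (T.treeDist i v w) := by
  induction i generalizing u v w with
  | zero => simp [treeDist]
  | succ i ih =>
    have := ih (T.par u) (T.par v) (T.par w)
    by_cases huv : u = v
    · subst huv; exact le_max_right _ _
    by_cases hvw : v = w
    · subst hvw; exact le_max_left _ _
    by_cases huw : u = w
    · subst huw; rw [treeDist_self]; exact Nat.zero_le _
    simp only [treeDist, if_neg huv, if_neg hvw, if_neg huw]
    by_cases h1 : T.edge u = T.edge v ∧ T.par u = T.par v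
    · rw [if_pos h1, h1.1, h1.2]
      exact le_max_right _ _
    by_cases h2 : T.edge v = T.edge w ∧ T.par v = T.par w
    · rw [if_pos h2, ← h2.1, ← h2.2]
      exact le_max_left _ _
    rw [if_neg h1, if_neg h2]
    split_ifs <;> omega

/-- Replacing `x` by a point closer to `x` than `q` is does not change the distance to `q`. -/
theorem treeDist_eq_of_lt {i : ℕ} {x y q : V}
    (h : T.treeDist i y x = 0 ∨ T.treeDist i y x < T.treeDist i x q) :
    T.treeDist i y q = T.treeDist i x q := by
  have h1 := T.treeDist_ultrametric i y x q
  have h2 := T.treeDist_ultrametric i x y q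
  rw [T.treeDist_comm i x y] at h2
  omega

theorem edge_ne_edge {u v : V} (hu : 0 < T.lev u) (huk : T.lev u ≤ k) (hv : 0 < T.lev v)
    (huv : T.lev v < T.lev u) : T.edge v ≠ T.edge u := by
  intro h
  have h1 := T.lev_le _ (T.edge_mem u hu huk) u (T.mem_edge u hu huk) (T.par v)
    (h ▸ T.par_mem_edge v hv (by omega))
  have h2 := T.lev_par v hv (by omega)
  omega

theorem par_eq_par [DecidableEq V] (h3 : ∀ E ∈ H, E.card = 3) {u v : V} (hu : 0 < T.lev u)
    (huk : T.lev u ≤ k) (huv : T.lev u = T.lev v) (h : T.edge u = T.edge v) :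
    T.par u = T.par v := by
  by_cases hne : u = v
  · rw [hne]
  have hpu := T.lev_par u hu huk
  have hpv := T.lev_par v (by omega) (by omega)
  have hupu : u ≠ T.par u := by intro h; rw [← h] at hpu; omega
  have hvpu : v ≠ T.par u := by intro h; rw [← h] at hpu; omega
  have hsub : ({u, v, T.par u} : Finset V) ⊆ T.edge u := by
    intro y hy
    simp only [Finset.mem_insert, Finset.mem_singleton] at hy
    rcases hy with rfl | rfl | rfl
    · exact T.mem_edge _ hu huk
    · exact h ▸ T.mem_edge _ (by omega) (by omega)
    · exact T.par_mem_edge _ hu huk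
  have heq := Finset.eq_of_subset_of_card_le hsub
    (by rw [h3 _ (T.edge_mem u hu huk), Finset.card_eq_three.2 ⟨u, v, T.par u, hne, hupu, hvpu, rfl⟩])
  have hm : T.par v ∈ ({u, v, T.par u} : Finset V) := by
    rw [heq, h]; exact T.par_mem_edge v (by omega) (by omega)
  simp only [Finset.mem_insert, Finset.mem_singleton] at hm
  rcases hm with hm | hm | hm
  · rw [hm] at hpv; omega
  · rw [hm] at hpv; omega
  · exact hm.symm

/-- Two vertices of the same level are joined by a Berge path of length `treeDist` through tree
hyperedges, whose inner vertices have smaller level. -/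
theorem exists_links [DecidableEq V] (h3 : ∀ E ∈ H, E.card = 3) (i : ℕ) (hik : i ≤ k) (u w : V)
    (hu : T.lev u = i) (hw : T.lev w = i) :
    ∃ l, Links (BergeLink H) u l w ∧ l.length = T.treeDist i u w ∧
      (l.map Prod.fst).Nodup ∧ (l.map Prod.snd).Nodup ∧
      (∀ E ∈ l.map Prod.fst, ∃ v, 0 < T.lev v ∧ T.lev v ≤ i ∧ E = T.edge v) ∧
      ∀ v ∈ l.map Prod.snd, (v = w ∧ u ≠ w) ∨ T.lev v < i := by
  induction i generalizing u w with
  | zero =>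
    exact ⟨[], T.root_unique u w hu hw, rfl, by simp, by simp, by simp, by simp⟩
  | succ i ih =>
    by_cases huw : u = w
    · exact ⟨[], huw, by rw [huw, treeDist_self]; rfl, by simp, by simp, by simp, by simp⟩
    by_cases he : T.edge u = T.edge w ∧ T.par u = T.par w
    · refine ⟨[(T.edge u, w)], ⟨⟨T.edge_mem u (by omega) (by omega), T.mem_edge u (by omega)
        (by omega), ?_⟩, rfl⟩, by simp [treeDist, huw, he], by simp, by simp, ?_, ?_⟩
      · exact he.1 ▸ T.mem_edge w (by omega) (by omega)
      · intro E hE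
        exact ⟨u, by omega, by omega, by simpa using hE⟩
      · intro v hv
        exact Or.inl ⟨by simpa using hv, huw⟩
    have hpu := T.lev_par u (by omega) (by omega)
    have hpw := T.lev_par w (by omega) (by omega)
    obtain ⟨l, hl, hlen, hnf, hns, hedge, hvert⟩ := ih (by omega) (T.par u) (T.par w)
      (by omega) (by omega)
    have hEuw : T.edge u ≠ T.edge w := fun h =>
      he ⟨h, T.par_eq_par h3 (by omega) (by omega) (by omega) h⟩
    have hnotin : ∀ x, T.lev x = i + 1 → T.edge x ∉ l.map Prod.fst := by
      intro x hx hm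
      obtain ⟨v, hv0, hvi, hv⟩ := hedge _ hm
      exact T.edge_ne_edge (by omega) (by omega) hv0 (by omega) hv.symm
    have hlow : ∀ v ∈ l.map Prod.snd, T.lev v < i + 1 := by
      intro v hv
      rcases hvert v hv with ⟨rfl, -⟩ | h <;> omega
    refine ⟨(T.edge u, T.par u) :: (l ++ [(T.edge w, w)]), ⟨⟨T.edge_mem u (by omega) (by omega),
      T.mem_edge u (by omega) (by omega), T.par_mem_edge u (by omega) (by omega)⟩,
      hl.append ⟨⟨T.edge_mem w (by omega) (by omega), T.par_mem_edge w (by omega) (by omega),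
        T.mem_edge w (by omega) (by omega)⟩, rfl⟩⟩, ?_, ?_, ?_, ?_, ?_⟩
    · simp [treeDist, huw, he, hlen]
    · simp only [List.map_cons, List.map_append, List.map_nil, List.nodup_cons, List.mem_append,
        List.mem_singleton, List.nodup_append]
      refine ⟨fun h => h.elim (hnotin u hu) hEuw, hnf, by simp, ?_⟩
      rintro a ha b rfl rfl
      exact hnotin w hw ha
    · simp only [List.map_cons, List.map_append, List.map_nil, List.nodup_cons, List.mem_append,
        List.mem_singleton, List.nodup_append]
      refine ⟨fun h => h.elim (fun h => ?_) (fun h => ?_), hns, by simp, ?_⟩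
      · rcases hvert _ h with ⟨h1, h2⟩ | h
        · exact h2 h1
        · omega
      · rw [h] at hpu; omega
      · rintro a ha b rfl rfl
        have := hlow _ ha
        omega
    · intro E hE
      simp only [List.map_cons, List.map_append, List.map_nil, List.mem_cons, List.mem_append,
        List.not_mem_nil, or_false] at hE
      rcases hE with rfl | hE | rfl
      · exact ⟨u, by omega, by omega, rfl⟩
      · obtain ⟨v, h1, h2, h3⟩ := hedge E hE
        exact ⟨v, h1, by omega, h3⟩
      · exact ⟨w, by omega, by omega, rfl⟩
    · intro v hv
      simp only [List.map_cons, List.map_append, List.map_nil, List.mem_cons, List.mem_append,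
        List.not_mem_nil, or_false] at hv
      rcases hv with rfl | hv | rfl
      · right; omega
      · right; exact hlow v hv
      · exact Or.inl ⟨rfl, huw⟩

theorem treeDist_le_or_le {i : ℕ} (a b q : V) :
    ∃ c, (c = a ∨ c = b) ∧ T.treeDist i a b ≤ T.treeDist i c q := by
  have h := T.treeDist_ultrametric i a q b
  rw [T.treeDist_comm i q b] at h
  rcases le_max_iff.1 h with h | h
  · exact ⟨a, Or.inl rfl, h⟩
  · exact ⟨b, Or.inr rfl, h⟩

/-- The hyperedge `E` containing `a` and `b` of level `i` has a third vertex from which a tree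
path may be entered. -/
def Exit {V : Type*} {H : Finset (Finset V)} {k : ℕ} (T : BergeTree H k) (i : ℕ) (E : Finset V)
    (a b : V) : Prop :=
  ∃ w ∈ E, w ≠ a ∧ w ≠ b ∧ (T.lev w + 1 = i ∨ T.lev w = i ∨
    (i < k ∧ T.lev w = i + 1 ∧ ∃ E' ∈ H, E' ≠ E ∧ w ∈ E' ∧ ∃ y ∈ E', T.lev y = i))

/-- All vertices `z` of one of the two branches of an edge `ab` with an exit are joined to the
hyperedge `E` of this edge by Berge paths of the same length that avoid level `i` up to a small
set `X`. -/
theorem Exit.exists_tail [DecidableEq V] {T : BergeTree H k} (h3 : ∀ E ∈ H, E.card = 3)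
    (hlin : ∀ E ∈ H, ∀ E' ∈ H, E ≠ E' → (E ∩ E').card ≤ 1)
    {i : ℕ} (hi : 1 ≤ i) (hik : i ≤ k) {E : Finset V} (hE : E ∈ H) {a b : V}
    (haE : a ∈ E) (hbE : b ∈ E) (ha : T.lev a = i) (hb : T.lev b = i)
    (hd : 2 ≤ T.treeDist i a b) (h : T.Exit i E a b) :
    ∃ c, (c = a ∨ c = b) ∧ ∃ (s : ℕ) (X : Finset V), a ∉ X ∧ b ∉ X ∧ s ≤ 2 * k ∧ X.card + 1 ≤ s ∧
      ∀ z, T.lev z = i → T.treeDist i z c < T.treeDist i a b → z ∉ X →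
        ∃ τ q, q ∈ E ∧ Links (BergeLink H) z τ q ∧ τ.length = s ∧ (τ.map Prod.fst).Nodup ∧
          (τ.map Prod.snd).Nodup ∧ (∀ v ∈ τ.map Prod.snd, T.lev v = i → v ∈ X) ∧
          ∀ e ∈ τ.map Prod.fst, (∃ v, 0 < T.lev v ∧ T.lev v ≤ i ∧ e = T.edge v) ∨
            (e ≠ E ∧ ∃ y ∈ e, y ∈ X ∧ T.lev y = i ∧ ∃ w ∈ e, T.lev w = i + 1) := by
  obtain ⟨w, hwE, hwa, hwb, hw | hw | ⟨hlt, hw, E', hE', hne, hwE', y, hyE', hy⟩⟩ := h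
  · obtain ⟨j, rfl⟩ : ∃ j, i = j + 1 := ⟨i - 1, by omega⟩
    obtain ⟨c', hc', hle⟩ := T.treeDist_le_or_le (i := j) (T.par a) (T.par b) w
    obtain ⟨c, hc, hcc⟩ : ∃ c, (c = a ∨ c = b) ∧ T.par c = c' := by
      rcases hc' with rfl | rfl
      · exact ⟨a, Or.inl rfl, rfl⟩
      · exact ⟨b, Or.inr rfl, rfl⟩
    subst hcc
    have hbd := T.treeDist_le j (T.par c) w
    refine ⟨c, hc, T.treeDist j (T.par c) w + 1, ∅, by simp, by simp, by omega, by simp, ?_⟩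
    intro z hz hzc _
    have hp := T.lev_par z (by omega) (by omega)
    obtain ⟨l, hl, hlen, hnf, hns, hedge, hvert⟩ := T.exists_links h3 j (by omega) (T.par z) w
      (by omega) (by omega)
    have heq : T.treeDist j (T.par z) w = T.treeDist j (T.par c) w := by
      apply T.treeDist_eq_of_lt
      rw [T.treeDist_par] at hle ⊢
      omega
    refine ⟨(T.edge z, T.par z) :: l, w, hwE, ⟨⟨T.edge_mem z (by omega) (by omega),
      T.mem_edge z (by omega) (by omega), T.par_mem_edge z (by omega) (by omega)⟩, hl⟩,
      by simp [hlen, heq], ?_, ?_, ?_, ?_⟩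
    · rw [List.map_cons, List.nodup_cons]
      refine ⟨fun hm => ?_, hnf⟩
      obtain ⟨v, hv0, hvi, hv⟩ := hedge _ hm
      exact T.edge_ne_edge (by omega) (by omega) hv0 (by omega) hv.symm
    · rw [List.map_cons, List.nodup_cons]
      refine ⟨fun hm => ?_, hns⟩
      rcases hvert _ hm with ⟨h1, h2⟩ | h
      · exact h2 h1
      · simp only at h; omega
    · intro v hv hvi
      rw [List.map_cons, List.mem_cons] at hv
      rcases hv with rfl | hv
      · simp only at hvi; omega
      · rcases hvert _ hv with ⟨rfl, -⟩ | h <;> omega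
    · intro e he
      rw [List.map_cons, List.mem_cons] at he
      rcases he with rfl | he
      · exact Or.inl ⟨z, by omega, by omega, rfl⟩
      · obtain ⟨v, h1, h2, h⟩ := hedge _ he
        exact Or.inl ⟨v, h1, by omega, h⟩
  · obtain ⟨c, hc, hle⟩ := T.treeDist_le_or_le (i := i) a b w
    have hbd := T.treeDist_le i c w
    refine ⟨c, hc, T.treeDist i c w, {w}, by simpa using hwa.symm, by simpa using hwb.symm,
      by omega, by simp; omega, ?_⟩
    intro z hz hzc _
    obtain ⟨l, hl, hlen, hnf, hns, hedge, hvert⟩ := T.exists_links h3 i hik z w hz hw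
    refine ⟨l, w, hwE, hl, ?_, hnf, hns, ?_, fun e he => Or.inl (hedge e he)⟩
    · rw [hlen]
      exact T.treeDist_eq_of_lt (Or.inr (by omega))
    · intro v hv hvi
      rcases hvert v hv with ⟨rfl, -⟩ | h
      · simp
      · omega
  · obtain ⟨c, hc, hle⟩ := T.treeDist_le_or_le (i := i) a b y
    have hbd := T.treeDist_le i c y
    have hyE : y ∉ E := by
      intro hyE
      have hlt := hlin E' hE' E hE hne
      have hsub : ({w, y} : Finset V) ⊆ E' ∩ E := by
        intro x hx
        simp only [Finset.mem_insert, Finset.mem_singleton] at hx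
        rcases hx with rfl | rfl <;> simp [*]
      have := Finset.card_le_card hsub
      rw [Finset.card_pair (by rintro rfl; omega)] at this
      omega
    refine ⟨c, hc, T.treeDist i c y + 1, {y}, ?_, ?_, by omega, by simp; omega, ?_⟩
    · rw [Finset.mem_singleton]; rintro rfl; exact hyE haE
    · rw [Finset.mem_singleton]; rintro rfl; exact hyE hbE
    intro z hz hzc _
    obtain ⟨l, hl, hlen, hnf, hns, hedge, hvert⟩ := T.exists_links h3 i hik z y hz hy
    refine ⟨l ++ [(E', w)], w, hwE, hl.append ⟨⟨hE', hyE', hwE'⟩, rfl⟩, ?_, ?_, ?_, ?_, ?_⟩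
    · rw [List.length_append, hlen, List.length_singleton,
        T.treeDist_eq_of_lt (Or.inr (lt_of_lt_of_le hzc hle))]
    · simp only [List.map_append, List.map_cons, List.map_nil, List.nodup_append,
        List.mem_singleton]
      refine ⟨hnf, by simp, ?_⟩
      rintro e he e' rfl rfl
      obtain ⟨v, h1, h2, rfl⟩ := hedge _ he
      have h4 := T.lev_le _ hE' w hwE' _ (T.par_mem_edge v h1 (by omega))
      have h5 := T.lev_par v h1 (by omega)
      omega
    · simp only [List.map_append, List.map_cons, List.map_nil, List.nodup_append,
        List.mem_singleton]
      refine ⟨hns, by simp, ?_⟩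
      rintro v hv v' rfl rfl
      rcases hvert _ hv with ⟨rfl, -⟩ | h <;> omega
    · intro v hv hvi
      simp only [List.map_append, List.map_cons, List.map_nil, List.mem_append,
        List.mem_singleton] at hv
      rcases hv with hv | rfl
      · rcases hvert v hv with ⟨rfl, -⟩ | h
        · simp
        · omega
      · omega
    · intro e he
      simp only [List.map_append, List.map_cons, List.map_nil, List.mem_append,
        List.mem_singleton] at he
      rcases he with he | rfl
      · exact Or.inl (hedge e he)
      · exact Or.inr ⟨hne, y, hyE', by simp, hy, w, hwE', hw⟩

/-- Hyperedges with two vertices in a subset `S` of level `i` that have exits and do not belong to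
the tree are few, unless there is a Berge cycle of length `2 * k + 1`. -/
theorem card_le_of_exit [DecidableEq V] (T : BergeTree H k) (h3 : ∀ E ∈ H, E.card = 3)
    (hlin : ∀ E ∈ H, ∀ E' ∈ H, E ≠ E' → (E ∩ E').card ≤ 1)
    (hB : ¬ HasBergeCycle H (2 * k + 1)) {i : ℕ} (hi : 1 ≤ i) (hik : i ≤ k)
    (S : Finset V) (hS : ∀ v ∈ S, T.lev v = i) (F : Finset (Finset V)) (hFH : F ⊆ H)
    (hex : ∀ E ∈ F, ∃ a ∈ S, ∃ b ∈ S, a ≠ b ∧ a ∈ E ∧ b ∈ E ∧ T.Exit i E a b)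
    (htree : ∀ E ∈ F, ∀ v, T.lev v = i → T.edge v ≠ E) :
    (F.card : ℝ) ≤ (2 * k - 1) * S.card := by
  by_contra hcon
  push Not at hcon
  have hk1 : (1 : ℝ) ≤ k := by exact_mod_cast hi.trans hik
  have hV : Nonempty V := by
    by_contra hV
    rw [not_nonempty_iff] at hV
    have : F = ∅ := by
      refine Finset.eq_empty_of_forall_notMem fun E hE => ?_
      obtain ⟨a, -⟩ := hex E hE
      exact hV.false a
    rw [this] at hcon
    have : (0 : ℝ) ≤ (2 * k - 1) * S.card := mul_nonneg (by linarith) (by positivity)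
    simp only [Finset.card_empty, Nat.cast_zero] at hcon
    linarith
  choose! a haS b hbS hab haE hbE hexit using hex
  obtain ⟨G, hGF, hGne, hGdeg⟩ := exists_subset_min_degree (fun E => ({a E, b E} : Finset V))
    (2 * k - 1) (by linarith) S F (by
      intro E hE x hx
      simp only [Finset.mem_insert, Finset.mem_singleton] at hx
      rcases hx with rfl | rfl
      · exact haS E hE
      · exact hbS E hE) hcon
  set ends : Finset V → Finset V := fun E => {a E, b E} with hends
  have hdeg : ∀ e ∈ G, ∀ v ∈ ends e, 2 * k ≤ (G.filter (fun e' => v ∈ ends e')).card := by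
    intro e he v hv
    have h := hGdeg e he v hv
    have h' : ((2 * k : ℕ) : ℝ) < ((G.filter (fun e' => v ∈ ends e')).card + 1 : ℕ) := by
      push_cast; linarith
    have := Nat.cast_lt.1 h'
    omega
  have htwo : ∀ e ∈ G, (ends e).card = 2 := fun e he => Finset.card_pair (hab e (hGF he))
  have hendsub : ∀ e ∈ G, ends e ⊆ e := by
    intro e he x hx
    simp only [hends, Finset.mem_insert, Finset.mem_singleton] at hx
    rcases hx with rfl | rfl
    · exact haE e (hGF he)
    · exact hbE e (hGF he)
  have heq_of : ∀ E ∈ G, ∀ E' ∈ H, a E ∈ E' → b E ∈ E' → E = E' := by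
    intro E hE E' hE' h1 h2
    by_contra hne
    have hle := hlin E (hFH (hGF hE)) E' hE' hne
    have hsub : ends E ⊆ E ∩ E' := by
      intro x hx
      refine Finset.mem_inter.2 ⟨hendsub E hE hx, ?_⟩
      simp only [hends, Finset.mem_insert, Finset.mem_singleton] at hx
      rcases hx with rfl | rfl <;> assumption
    have := Finset.card_le_card hsub
    rw [htwo E hE] at this
    omega
  have hinj : Set.InjOn ends G := by
    intro E hE E' hE' h
    refine heq_of E hE E' (hFH (hGF hE')) (hendsub E' hE' ?_) (hendsub E' hE' ?_)
    · rw [← h]; simp [hends]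
    · rw [← h]; simp [hends]
  have hnt : ∀ e ∈ G, ∀ v, 0 < T.lev v → T.lev v ≤ i → e ≠ T.edge v := by
    intro e he v hv0 hvi hev
    have h1 := T.lev_le e (hFH (hGF he)) (a e) (haE e (hGF he)) (T.par v)
      (by rw [hev]; exact T.par_mem_edge v hv0 (hvi.trans hik))
    rw [hS _ (haS e (hGF he))] at h1
    have h2 := T.lev_par v hv0 (hvi.trans hik)
    exact htree e (hGF he) v (by omega) hev.symm
  obtain ⟨e₀, he₀, hmax⟩ := Finset.exists_max_image G (fun e => T.treeDist i (a e) (b e)) hGne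
  set t := T.treeDist i (a e₀) (b e₀) with ht
  have ht2 : 2 ≤ t := by
    obtain ⟨j, rfl⟩ : ∃ j, i = j + 1 := ⟨i - 1, by omega⟩
    have hla := hS _ (haS e₀ (hGF he₀))
    have hlb := hS _ (hbS e₀ (hGF he₀))
    have hne : T.edge (a e₀) ≠ T.edge (b e₀) := by
      intro h
      refine hnt e₀ he₀ (a e₀) (by omega) (by omega) ?_
      refine heq_of e₀ he₀ _ (T.edge_mem _ (by omega) (by omega))
        (T.mem_edge _ (by omega) (by omega)) ?_
      rw [h]
      exact T.mem_edge _ (by omega) (by omega)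
    rw [ht, treeDist, if_neg (hab e₀ (hGF he₀)), if_neg (fun h => hne h.1)]
    omega
  have htk : t ≤ 2 * i := T.treeDist_le _ _ _
  have hlev : ∀ e ∈ G, ∀ v ∈ ends e, T.lev v = i := by
    intro e he v hv
    simp only [hends, Finset.mem_insert, Finset.mem_singleton] at hv
    rcases hv with rfl | rfl
    · exact hS _ (haS e (hGF he))
    · exact hS _ (hbS e (hGF he))
  have hlink : ∀ u e v, EdgeLink G ends u e v → BergeLink H u e v ∧ T.lev u = i ∧ T.lev v = i ∧
      T.treeDist i u v ≤ t := by
    rintro u e v ⟨he, h, -⟩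
    have hu : u ∈ ends e := by rw [h]; simp
    have hv : v ∈ ends e := by rw [h]; simp
    refine ⟨⟨hFH (hGF he), hendsub e he hu, hendsub e he hv⟩, hlev e he u hu, hlev e he v hv, ?_⟩
    have hm := hmax e he
    simp only [hends, Finset.mem_insert, Finset.mem_singleton] at hu hv
    rcases hu with rfl | rfl <;> rcases hv with rfl | rfl
    · rw [treeDist_self]; omega
    · exact hm
    · rw [T.treeDist_comm]; exact hm
    · rw [treeDist_self]; omega
  have hwalk : ∀ l u w, Links (EdgeLink G ends) u l w → T.lev u = i →
      T.treeDist i w u ≤ t ∧ ∀ y ∈ u :: l.map Prod.snd, T.lev y = i := by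
    intro l
    induction l with
    | nil =>
      rintro u w rfl hu
      exact ⟨by rw [treeDist_self]; omega, by simpa using hu⟩
    | cons p l ih =>
      intro u w h hu
      obtain ⟨-, -, hp, hd⟩ := hlink _ _ _ h.1
      obtain ⟨h1, h2⟩ := ih _ _ h.2 hp
      refine ⟨?_, ?_⟩
      · have := T.treeDist_ultrametric i w p.2 u
        rw [T.treeDist_comm i p.2 u] at this
        omega
      · intro y hy
        rcases List.mem_cons.1 hy with rfl | hy
        · exact hu
        · exact h2 y hy
  have hcross : ∀ l u w, Links (EdgeLink G ends) u l w → T.lev u = i → l.length + t = 2 * k + 1 →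
      (u :: l.map Prod.snd).Nodup → T.treeDist i w u < t := by
    intro l u w hl hu hlen hnd
    obtain ⟨h1, h2⟩ := hwalk l u w hl hu
    refine lt_of_le_of_ne h1 fun hd => hB ?_
    obtain ⟨τ, hτ, hτlen, hτf, hτs, hτe, hτv⟩ := T.exists_links h3 i hik w u (h2 w hl.end_mem) hu
    have hlB : Links (BergeLink H) u l w := hl.imp fun _ _ _ h => (hlink _ _ _ h).1
    have hcyc := (hlB.append hτ).hasBergeCycle ?_ ?_
    · rwa [List.length_append, hτlen, hd, hlen] at hcyc
    · rw [List.map_append, List.nodup_append]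
      refine ⟨hl.nodup_fst_of_edgeLink hnd, hτf, ?_⟩
      rintro e he e' he' rfl
      obtain ⟨v, hv0, hvi, hv⟩ := hτe _ he'
      exact hnt e (hl.mem_of_edgeLink he).1 v hv0 hvi hv
    · rw [List.nodup_cons] at hnd
      rw [List.map_append, List.nodup_append]
      refine ⟨hnd.2, hτs, ?_⟩
      rintro v hv v' hv' rfl
      have := h2 v (List.mem_cons_of_mem _ hv)
      rcases hτv v hv' with ⟨rfl, -⟩ | h
      · exact hnd.1 hv
      · omega
  have hsymm : ∀ u e v, EdgeLink G ends u e v → EdgeLink G ends v e u := by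
    rintro u e v ⟨h1, h2, h⟩
    exact ⟨h1, by rw [h2, Finset.pair_comm], h.symm⟩
  have hendlink : EdgeLink G ends (a e₀) e₀ (b e₀) := ⟨he₀, rfl, hab e₀ (hGF he₀)⟩
  have hmono : ∀ u e v e' w, EdgeLink G ends u e v → EdgeLink G ends v e' w →
      T.treeDist i w u < t := by
    intro u e v e' w he he'
    by_cases huw : u = w
    · rw [huw, treeDist_self]; omega
    by_cases htk' : t = 2 * k
    · have := hcross [(e₀, b e₀)] (a e₀) (b e₀) ⟨hendlink, rfl⟩ (hlink _ _ _ hendlink).2.1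
        (by simp [htk']; omega) (by simpa using hab e₀ (hGF he₀))
      rw [T.treeDist_comm] at this
      omega
    obtain ⟨l, x, hl, hlen, hnd, hav⟩ := exists_links_avoiding hinj htwo hdeg (2 * k - t) {u, w} v
      ⟨e, he.1, by rw [he.2.1]; simp⟩ (by rw [Finset.card_pair huw]; omega)
      (by simp [he.2.2.symm, he'.2.2])
    have h1 := hcross ((e, v) :: l) u x ⟨he, hl⟩ (hlink _ _ _ he).2.1 (by simp; omega)
      (List.nodup_cons.2 ⟨fun hm => hav u hm (by simp), hnd⟩)
    have h2 := hcross ((e', v) :: l) w x ⟨hsymm _ _ _ he', hl⟩ (hlink _ _ _ he').2.2.1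
      (by simp; omega) (List.nodup_cons.2 ⟨fun hm => hav w hm (by simp), hnd⟩)
    have := T.treeDist_ultrametric i w x u
    rw [T.treeDist_comm i w x] at this
    omega
  obtain ⟨c, hc, s, X, haX, hbX, hsk, hXs, htail⟩ := (hexit e₀ (hGF he₀)).exists_tail h3 hlin hi hik
    (hFH (hGF he₀)) (haE e₀ (hGF he₀)) (hbE e₀ (hGF he₀)) (hS _ (haS e₀ (hGF he₀)))
    (hS _ (hbS e₀ (hGF he₀))) ht2
  obtain ⟨y₀, y₁, hy, hy₀X, hy₁X, heven, hodd⟩ : ∃ y₀ y₁, EdgeLink G ends y₀ e₀ y₁ ∧ y₀ ∉ X ∧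
      y₁ ∉ X ∧ (Even (2 * k - s) → y₁ = c) ∧ (Odd (2 * k - s) → y₀ = c) := by
    have hns : Even (2 * k - s) → ¬ Odd (2 * k - s) := fun h => Nat.not_odd_iff_even.2 h
    rcases Nat.even_or_odd (2 * k - s) with hp | hp <;> rcases hc with rfl | rfl
    · exact ⟨_, _, hsymm _ _ _ hendlink, hbX, haX, fun _ => rfl, fun h => (hns hp h).elim⟩
    · exact ⟨_, _, hendlink, haX, hbX, fun _ => rfl, fun h => (hns hp h).elim⟩
    · exact ⟨_, _, hendlink, haX, hbX, fun h => (hns h hp).elim, fun _ => rfl⟩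
    · exact ⟨_, _, hsymm _ _ _ hendlink, hbX, haX, fun h => (hns h hp).elim, fun _ => rfl⟩
  obtain ⟨l, z, hl, hlen, hnd, hav⟩ := exists_links_avoiding hinj htwo hdeg (2 * k - s)
    (insert y₀ X) y₁ ⟨e₀, he₀, by rw [hy.2.1]; simp⟩
    (by rw [Finset.card_insert_of_notMem hy₀X]; omega) (by simp [hy.2.2.symm, hy₁X])
  have hy₁ := (hlink _ _ _ hy).2.2.1
  obtain ⟨-, hlevl⟩ := hwalk l y₁ z hl hy₁
  have hzc : T.treeDist i z c < t := by
    obtain ⟨h1, h2⟩ := hl.alternating (r := fun x y => T.treeDist i x y < t)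
      (fun u => by rw [treeDist_self]; omega)
      (fun u v w huv hvw => lt_of_le_of_lt (T.treeDist_ultrametric i u v w) (max_lt huv hvw))
      hmono hy
    rw [hlen] at h1 h2
    rcases Nat.even_or_odd (2 * k - s) with hp | hp
    · rw [← heven hp]; exact h1 hp
    · rw [← hodd hp]; exact h2 hp
  have hzX : z ∉ X := fun h => hav z hl.end_mem (Finset.mem_insert_of_mem h)
  obtain ⟨τ, q, hq, hτ, hτlen, hτf, hτs, hτv, hτe⟩ := htail z (hlevl z hl.end_mem) hzc hzX
  have hlB : Links (BergeLink H) y₁ l z := hl.imp fun _ _ _ h => (hlink _ _ _ h).1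
  have hclose : Links (BergeLink H) q [(e₀, y₁)] y₁ :=
    ⟨⟨hFH (hGF he₀), hq, (hlink _ _ _ hy).1.2.2⟩, rfl⟩
  have he₀l : e₀ ∉ l.map Prod.fst := fun hm =>
    hav y₀ ((hl.mem_of_edgeLink hm).2 y₀ (by rw [hy.2.1]; simp)) (by simp)
  have hcyc := ((hlB.append hτ).append hclose).hasBergeCycle ?_ ?_
  · rw [List.length_append, List.length_append, hlen, hτlen, List.length_singleton,
      show 2 * k - s + s + 1 = 2 * k + 1 by omega] at hcyc
    exact hB hcyc
  · simp only [List.map_append, List.nodup_append, List.map_cons, List.map_nil, List.mem_append,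
      List.mem_singleton]
    refine ⟨⟨hl.nodup_fst_of_edgeLink hnd, hτf, ?_⟩, by simp, ?_⟩
    · rintro e he e' he' rfl
      obtain ⟨heG, hesub⟩ := hl.mem_of_edgeLink he
      rcases hτe e he' with ⟨v, hv0, hvi, hv⟩ | ⟨-, y, hye, hyX, hyi, w, hwe, hw⟩
      · exact hnt e heG v hv0 hvi hv
      · have hyends : y ∈ ends e := by
          by_contra hyn
          have hwn : w ∉ insert y (ends e) := by
            intro h
            rcases Finset.mem_insert.1 h with rfl | h
            · omega
            · have := hlev e heG w h
              omega
          have hsub : insert w (insert y (ends e)) ⊆ e := by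
            intro x hx
            rcases Finset.mem_insert.1 hx with rfl | hx
            · exact hwe
            · rcases Finset.mem_insert.1 hx with rfl | hx
              · exact hye
              · exact hendsub e heG hx
          have := Finset.card_le_card hsub
          rw [Finset.card_insert_of_notMem hwn, Finset.card_insert_of_notMem hyn, htwo e heG,
            h3 e (hFH (hGF heG))] at this
          omega
        exact hav y (hesub y hyends) (Finset.mem_insert_of_mem hyX)
    · rintro e he e' rfl rfl
      rcases he with he | he
      · exact he₀l he
      · rcases hτe e he with ⟨v, hv0, hvi, hv⟩ | ⟨h, -⟩
        · exact hnt e he₀ v hv0 hvi hv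
        · exact h rfl
  · have hnd' := List.nodup_cons.1 hnd
    simp only [List.map_append, List.nodup_append, List.map_cons, List.map_nil, List.mem_append,
      List.mem_singleton]
    refine ⟨⟨hnd'.2, hτs, ?_⟩, by simp, ?_⟩
    · rintro v hv v' hv' rfl
      have hm := List.mem_cons_of_mem y₁ hv
      exact hav v hm (Finset.mem_insert_of_mem (hτv v hv' (hlevl v hm)))
    · rintro v hv v' rfl rfl
      rcases hv with hv | hv
      · exact hnd'.1 hv
      · exact hy₁X (hτv v hv hy₁)

theorem exists_eq_triple [DecidableEq V] {E : Finset V} (hE : E.card = 3) {a b : V} (ha : a ∈ E)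
    (hb : b ∈ E) (hab : a ≠ b) : ∃ c, c ≠ a ∧ c ≠ b ∧ E = {a, b, c} := by
  have hsub : ({a, b} : Finset V) ⊆ E := by
    intro x hx
    simp only [Finset.mem_insert, Finset.mem_singleton] at hx
    rcases hx with rfl | rfl <;> assumption
  obtain ⟨c, hcE, hc⟩ := Finset.exists_mem_notMem_of_card_lt_card
    (s := {a, b}) (t := E) (by rw [Finset.card_pair hab]; omega)
  simp only [Finset.mem_insert, Finset.mem_singleton, not_or] at hc
  refine ⟨c, hc.1, hc.2, (Finset.eq_of_subset_of_card_le ?_ ?_).symm⟩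
  · intro x hx
    simp only [Finset.mem_insert, Finset.mem_singleton] at hx
    rcases hx with rfl | rfl | rfl <;> assumption
  · rw [hE, Finset.card_eq_three.2 ⟨a, b, c, hab, Ne.symm hc.1, Ne.symm hc.2, rfl⟩]

/-- The bound of `card_le_of_exit` with one more `S.card`, without assuming that the hyperedges
avoid the tree. -/
theorem card_le_of_exit_of_tree [DecidableEq V] (T : BergeTree H k) (h3 : ∀ E ∈ H, E.card = 3)
    (hlin : ∀ E ∈ H, ∀ E' ∈ H, E ≠ E' → (E ∩ E').card ≤ 1)
    (hB : ¬ HasBergeCycle H (2 * k + 1)) {i : ℕ} (hi : 1 ≤ i) (hik : i ≤ k)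
    (S : Finset V) (hS : ∀ v ∈ S, T.lev v = i) (F : Finset (Finset V)) (hFH : F ⊆ H)
    (hex : ∀ E ∈ F, ∃ a ∈ S, ∃ b ∈ S, a ≠ b ∧ a ∈ E ∧ b ∈ E ∧ T.Exit i E a b) :
    F.card ≤ 2 * k * S.card := by
  classical
  have h1 := T.card_le_of_exit h3 hlin hB hi hik S hS (F.filter (fun E => E ∉ S.image T.edge))
    ((Finset.filter_subset _ _).trans hFH) (fun E hE => hex E (Finset.mem_filter.1 hE).1) (by
      intro E hE v hv hvE
      rw [Finset.mem_filter] at hE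
      obtain ⟨a, ha, b, hb, hab, haE, hbE, -⟩ := hex E hE.1
      obtain ⟨c, -, -, hc⟩ := exists_eq_triple (h3 E (hFH hE.1)) haE hbE hab
      have hva : v ∈ S → False := fun hvS => hE.2 (Finset.mem_image.2 ⟨v, hvS, hvE⟩)
      have hvm : v ∈ E := hvE ▸ T.mem_edge v (by omega) (by omega)
      have hpm : T.par v ∈ E := hvE ▸ T.par_mem_edge v (by omega) (by omega)
      have hp := T.lev_par v (by omega) (by omega)
      rw [hc] at hvm hpm
      simp only [Finset.mem_insert, Finset.mem_singleton] at hvm hpm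
      have h1 := hS a ha
      have h2 := hS b hb
      rcases hvm with rfl | rfl | rfl
      · exact hva ha
      · exact hva hb
      · rcases hpm with h | h | h <;> rw [h] at hp <;> omega)
  have h2 : (F.filter (fun E => E ∈ S.image T.edge)).card ≤ S.card := by
    refine le_trans (Finset.card_le_card ?_) (Finset.card_image_le (s := S) (f := T.edge))
    exact fun E hE => (Finset.mem_filter.1 hE).2
  have h3 := Finset.card_filter_add_card_filter_not (s := F) (fun E => E ∈ S.image T.edge)
  have h2' : ((F.filter (fun E => E ∈ S.image T.edge)).card : ℝ) ≤ S.card := by exact_mod_cast h2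
  have h3' : ((F.filter (fun E => E ∈ S.image T.edge)).card : ℝ)
    + (F.filter (fun E => E ∉ S.image T.edge)).card = F.card := by exact_mod_cast h3
  have : (F.card : ℝ) ≤ 2 * k * S.card := by linarith
  exact_mod_cast this

end Basic

section Counting

variable {V : Type*} {H : Finset (Finset V)} {k : ℕ} (T : BergeTree H k)

/-- The vertices of level `i`. -/
def level [Fintype V] (i : ℕ) : Finset V := Finset.univ.filter (fun v => T.lev v = i)

theorem mem_level [Fintype V] {i : ℕ} {v : V} : v ∈ T.level i ↔ T.lev v = i := by
  simp [level]

variable [DecidableEq V]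

/-- The number of vertices of level `i` in `E`. -/
def count (i : ℕ) (E : Finset V) : ℕ := (E.filter (fun v => T.lev v = i)).card

theorem count_triple (i : ℕ) {a b c : V} (hab : a ≠ b) (hca : c ≠ a) (hcb : c ≠ b) :
    T.count i {a, b, c} = (if T.lev a = i then 1 else 0) + (if T.lev b = i then 1 else 0)
      + (if T.lev c = i then 1 else 0) := by
  rw [count, Finset.card_filter, Finset.sum_insert (by simp [hab, hca.symm]),
    Finset.sum_insert (by simp [hcb.symm]), Finset.sum_singleton, add_assoc]

theorem exists_pair_of_two_le_count {i : ℕ} {E : Finset V} (h3 : E.card = 3)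
    (h : 2 ≤ T.count i E) :
    ∃ a b c, a ≠ b ∧ c ≠ a ∧ c ≠ b ∧ E = {a, b, c} ∧ T.lev a = i ∧ T.lev b = i := by
  obtain ⟨a, ha, b, hb, hab⟩ := Finset.one_lt_card.1 (show 1 < _ from h)
  rw [Finset.mem_filter] at ha hb
  obtain ⟨c, hca, hcb, hc⟩ := exists_eq_triple h3 ha.1 hb.1 hab
  exact ⟨a, b, c, hab, hca, hcb, hc, ha.2, hb.2⟩

theorem count_zero_le_one (h3 : ∀ E ∈ H, E.card = 3) {E : Finset V} (hE : E ∈ H) :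
    T.count 0 E ≤ 1 := by
  by_contra h
  obtain ⟨a, b, c, hab, -, -, -, ha, hb⟩ :=
    T.exists_pair_of_two_le_count (h3 E hE) (show 2 ≤ T.count 0 E by omega)
  exact hab (T.root_unique a b ha hb)

variable [Fintype V]

open Classical in
/-- The vertices of level `i + 1` that lie in exactly one hyperedge meeting level `i`, and this
hyperedge has two vertices of level `i`. -/
noncomputable def solo (i : ℕ) : Finset V :=
  (T.level (i + 1)).filter (fun w => ∃ E ∈ H, w ∈ E ∧ T.count i E = 2 ∧
    ∀ E' ∈ H, w ∈ E' → (∃ y ∈ E', T.lev y = i) → E' = E)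

/-- The hyperedges with two vertices of level `i` and a third vertex in `solo i`. -/
noncomputable def soloEdges (i : ℕ) : Finset (Finset V) :=
  H.filter (fun E => T.count i E = 2 ∧ ∃ w ∈ E, w ∈ T.solo i)

theorem card_soloEdges_le (i : ℕ) : (T.soloEdges i).card ≤ (T.solo i).card := by
  have h : ∀ E ∈ T.soloEdges i, ∃ w ∈ T.solo i, w ∈ E := by
    intro E hE
    obtain ⟨-, -, w, hw, hs⟩ := Finset.mem_filter.1 hE
    exact ⟨w, hs, hw⟩
  have hlow : ∀ E ∈ T.soloEdges i, E ∈ H ∧ ∃ y ∈ E, T.lev y = i := by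
    intro E hE
    obtain ⟨hEH, h2, -⟩ := Finset.mem_filter.1 hE
    have : 0 < (E.filter (fun v => T.lev v = i)).card := by
      have : (E.filter (fun v => T.lev v = i)).card = 2 := h2
      omega
    obtain ⟨y, hy⟩ := Finset.card_pos.1 this
    rw [Finset.mem_filter] at hy
    exact ⟨hEH, y, hy.1, hy.2⟩
  rcases isEmpty_or_nonempty V with hV | hV
  · have : T.soloEdges i = ∅ := by
      refine Finset.eq_empty_of_forall_notMem fun E hE => ?_
      obtain ⟨w, -⟩ := h E hE
      exact hV.false w
    simp [this]
  choose! w hw hwE using h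
  refine Finset.card_le_card_of_injOn w hw ?_
  intro E hE E' hE' hww
  obtain ⟨-, E₀, -, -, -, huniq⟩ := Finset.mem_filter.1 (hw E hE)
  rw [huniq E (hlow E hE).1 (hwE E hE) (hlow E hE).2,
    huniq E' (hlow E' hE').1 (hww ▸ hwE E' hE') (hlow E' hE').2]

theorem card_pair_edges_le (h3 : ∀ E ∈ H, E.card = 3)
    (hlin : ∀ E ∈ H, ∀ E' ∈ H, E ≠ E' → (E ∩ E').card ≤ 1)
    (hB : ¬ HasBergeCycle H (2 * k + 1)) {i : ℕ} (hik : i < k) :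
    (H.filter (fun E => 2 ≤ T.count i E ∧ E ∉ T.soloEdges i)).card ≤ 2 * k * (T.level i).card := by
  rcases Nat.eq_zero_or_pos i with rfl | hi
  · rw [Finset.filter_eq_empty_iff.2 (fun E hE h => by
      have := T.count_zero_le_one h3 hE
      omega), Finset.card_empty]
    exact Nat.zero_le _
  refine T.card_le_of_exit_of_tree h3 hlin hB hi hik.le _ (fun v hv => T.mem_level.1 hv) _
    (Finset.filter_subset _ _) ?_
  intro E hE
  obtain ⟨hEH, h2, hns⟩ := Finset.mem_filter.1 hE
  obtain ⟨a, b, c, hab, hca, hcb, rfl, ha, hb⟩ := T.exists_pair_of_two_le_count (h3 E hEH) h2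
  refine ⟨a, T.mem_level.2 ha, b, T.mem_level.2 hb, hab, by simp, by simp, c, by simp, hca, hcb, ?_⟩
  have h1 := T.lev_le _ hEH a (by simp) c (by simp)
  have h1' := T.lev_le _ hEH c (by simp) a (by simp)
  by_cases hc : T.lev c = i + 1
  · refine Or.inr (Or.inr ⟨hik, hc, ?_⟩)
    by_contra hcon
    push Not at hcon
    have hcount : T.count i {a, b, c} = 2 := by
      rw [T.count_triple i hab hca hcb, if_pos ha, if_pos hb, if_neg (by omega)]
    refine hns (Finset.mem_filter.2 ⟨hEH, hcount, c, by simp, Finset.mem_filter.2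
      ⟨T.mem_level.2 hc, _, hEH, by simp, hcount, ?_⟩⟩)
    rintro E' hE' hcE' ⟨y, hy, hyl⟩
    by_contra hne
    exact hcon E' hE' hne hcE' y hy hyl
  · omega

theorem card_up_edges_le (h3 : ∀ E ∈ H, E.card = 3)
    (hlin : ∀ E ∈ H, ∀ E' ∈ H, E ≠ E' → (E ∩ E').card ≤ 1)
    (hB : ¬ HasBergeCycle H (2 * k + 1)) {i : ℕ} (hik : i < k) :
    (H.filter (fun E => T.count i E = 1 ∧ T.count (i + 1) E = 2)).card
      ≤ 2 * k * (T.level (i + 1) \ T.solo i).card := by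
  refine T.card_le_of_exit_of_tree h3 hlin hB (Nat.succ_pos i) hik _
    (fun v hv => T.mem_level.1 (Finset.mem_sdiff.1 hv).1) _ (Finset.filter_subset _ _) ?_
  intro E hE
  obtain ⟨hEH, h1, h2⟩ := Finset.mem_filter.1 hE
  obtain ⟨a, b, c, hab, hca, hcb, rfl, ha, hb⟩ := T.exists_pair_of_two_le_count (h3 E hEH) h2.ge
  have hc : T.lev c = i := by
    rw [T.count_triple i hab hca hcb] at h1
    by_contra hc
    rw [if_neg (by omega), if_neg (by omega), if_neg hc] at h1
    omega
  have hns : ∀ v ∈ ({a, b, c} : Finset V), v ∉ T.solo i := by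
    intro v hv hs
    obtain ⟨-, E', hE', -, hcount, huniq⟩ := Finset.mem_filter.1 hs
    rw [← huniq _ hEH hv ⟨c, by simp, hc⟩] at hcount
    omega
  exact ⟨a, Finset.mem_sdiff.2 ⟨T.mem_level.2 ha, hns a (by simp)⟩, b,
    Finset.mem_sdiff.2 ⟨T.mem_level.2 hb, hns b (by simp)⟩, hab, by simp, by simp, c, by simp,
    hca, hcb, Or.inl (by omega)⟩

theorem count_le (h3 : ∀ E ∈ H, E.card = 3) (i : ℕ) {E : Finset V} (hE : E ∈ H) :
    T.count i E ≤ (if 2 ≤ T.count i E ∧ E ∉ T.soloEdges i then 3 else 0)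
      + (if E ∈ T.soloEdges i then 2 else 0)
      + (if T.count i E = 1 ∧ T.count (i + 1) E = 2 then 1 else 0)
      + (if 1 ≤ i ∧ 2 ≤ T.count (i - 1) E then 1 else 0) := by
  obtain ⟨a, b, c, hab, hac, hbc, rfl⟩ := Finset.card_eq_three.1 (h3 E hE)
  have hs : {a, b, c} ∈ T.soloEdges i → T.count i {a, b, c} = 2 := fun h =>
    (Finset.mem_filter.1 h).2.1
  have hl : ∀ u ∈ ({a, b, c} : Finset V), ∀ v ∈ ({a, b, c} : Finset V), T.lev u ≤ T.lev v + 1 :=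
    T.lev_le _ hE
  have h1 := hl a (by simp) b (by simp)
  have h2 := hl b (by simp) a (by simp)
  have h3 := hl a (by simp) c (by simp)
  have h4 := hl c (by simp) a (by simp)
  have h5 := hl b (by simp) c (by simp)
  have h6 := hl c (by simp) b (by simp)
  have ht : ∀ j, T.count j {a, b, c} = (if T.lev a = j then 1 else 0)
      + (if T.lev b = j then 1 else 0) + (if T.lev c = j then 1 else 0) := fun j =>
    T.count_triple j hab hac.symm hbc.symm
  have hone : T.count i {a, b, c} = 1 → T.count (i + 1) {a, b, c} = 2 ∨
      (1 ≤ i ∧ 2 ≤ T.count (i - 1) {a, b, c}) := by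
    simp only [ht]
    clear ht hs hl
    generalize T.lev a = p at *
    generalize T.lev b = q at *
    generalize T.lev c = r at *
    by_cases hp : p = i <;> by_cases hq : q = i <;> by_cases hr : r = i <;> grind
  have hle : T.count i {a, b, c} ≤ 3 := by
    rw [ht]
    split_ifs <;> omega
  generalize T.count i {a, b, c} = m at *
  by_cases hsolo : ({a, b, c} : Finset V) ∈ T.soloEdges i
  · rw [if_pos hsolo]
    have := hs hsolo
    omega
  · simp only [hsolo, not_false_eq_true, and_true, if_false]
    clear ht hl hs
    split_ifs <;> omega

theorem sum_degree_eq (i : ℕ) :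
    ∑ v ∈ T.level i, (H.filter (fun E => v ∈ E)).card = ∑ E ∈ H, T.count i E := by
  have h := Finset.sum_card_bipartiteAbove_eq_sum_card_bipartiteBelow (s := T.level i) (t := H)
    (fun (v : V) (E : Finset V) => v ∈ E)
  refine h.trans (Finset.sum_congr rfl fun E _ => congrArg Finset.card ?_)
  ext v
  simp [Finset.mem_bipartiteBelow, mem_level, and_comm]

theorem solo_subset (i : ℕ) : T.solo i ⊆ T.level (i + 1) := Finset.filter_subset _ _

theorem card_two_le_count_le (h3 : ∀ E ∈ H, E.card = 3)
    (hlin : ∀ E ∈ H, ∀ E' ∈ H, E ≠ E' → (E ∩ E').card ≤ 1)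
    (hB : ¬ HasBergeCycle H (2 * k + 1)) {i : ℕ} (hik : i < k) :
    (H.filter (fun E => 2 ≤ T.count i E)).card
      ≤ 2 * k * (T.level i).card + (T.level (i + 1)).card := by
  have h1 := T.card_pair_edges_le h3 hlin hB hik
  have h2 := (T.card_soloEdges_le i).trans (Finset.card_le_card (T.solo_subset i))
  have h3 : H.filter (fun E => 2 ≤ T.count i E)
      ⊆ H.filter (fun E => 2 ≤ T.count i E ∧ E ∉ T.soloEdges i) ∪ T.soloEdges i := by
    intro E hE
    rw [Finset.mem_filter] at hE
    rw [Finset.mem_union, Finset.mem_filter]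
    tauto
  have := (Finset.card_le_card h3).trans (Finset.card_union_le _ _)
  omega

theorem sum_degree_le (h3 : ∀ E ∈ H, E.card = 3)
    (hlin : ∀ E ∈ H, ∀ E' ∈ H, E ≠ E' → (E ∩ E').card ≤ 1)
    (hB : ¬ HasBergeCycle H (2 * k + 1)) {i : ℕ} (hik : i < k)
    (hmono : i ≠ 0 → (T.level (i - 1)).card ≤ (T.level i).card) :
    ∑ v ∈ T.level i, (H.filter (fun E => v ∈ E)).card
      ≤ 9 * k * (T.level i).card + 2 * k * (T.level (i + 1)).card := by
  have hF := T.card_pair_edges_le h3 hlin hB hik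
  have hS := T.card_soloEdges_le i
  have hA := T.card_up_edges_le h3 hlin hB hik
  have hsd := Finset.card_sdiff_add_card_eq_card (T.solo_subset i)
  have hM : (H.filter (fun E => 1 ≤ i ∧ 2 ≤ T.count (i - 1) E)).card
      ≤ 2 * k * (T.level i).card + (T.level i).card := by
    rcases Nat.eq_zero_or_pos i with rfl | hi
    · simp
    · have h := T.card_two_le_count_le h3 hlin hB (show i - 1 < k by omega)
      rw [Nat.sub_add_cancel hi] at h
      have h' := Nat.mul_le_mul_left (2 * k) (hmono hi.ne')
      have : H.filter (fun E => 1 ≤ i ∧ 2 ≤ T.count (i - 1) E)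
          = H.filter (fun E => 2 ≤ T.count (i - 1) E) := by
        simp only [show 1 ≤ i from hi, true_and]
      rw [this]
      omega
  have hsum := Finset.sum_le_sum (fun E hE => T.count_le h3 i (E := E) hE)
  have hSS : H.filter (fun E => E ∈ T.soloEdges i) = T.soloEdges i := by
    rw [Finset.filter_mem_eq_inter, Finset.inter_eq_right]
    exact Finset.filter_subset _ _
  rw [← T.sum_degree_eq, Finset.sum_add_distrib, Finset.sum_add_distrib, Finset.sum_add_distrib,
    ← Finset.sum_filter, ← Finset.sum_filter, ← Finset.sum_filter, ← Finset.sum_filter,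
    Finset.sum_const, Finset.sum_const, Finset.sum_const, Finset.sum_const, hSS] at hsum
  simp only [smul_eq_mul, mul_one] at hsum
  have hk : 1 ≤ k := by omega
  nlinarith [Nat.mul_le_mul_right (T.solo i).card hk, Nat.mul_le_mul_right (T.level i).card hk]

end Counting

end BergeTree

/-- `v` can be reached from `x` in `i` steps. -/
def ReachIn {V : Type*} (H : Finset (Finset V)) (x : V) : ℕ → V → Prop
  | 0, v => v = x
  | i + 1, v => ∃ u, ∃ E ∈ H, u ∈ E ∧ v ∈ E ∧ ReachIn H x i u

theorem exists_bergeTree {V : Type*} (H : Finset (Finset V)) (k : ℕ) (x : V) :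
    ∃ T : BergeTree H k, T.lev x = 0 := by
  classical
  have hex : ∀ v, ∃ i, i = k + 1 ∨ ReachIn H x i v := fun v => ⟨k + 1, Or.inl rfl⟩
  have hle : ∀ v, Nat.find (hex v) ≤ k + 1 := fun v => Nat.find_min' _ (Or.inl rfl)
  have hreach : ∀ v, Nat.find (hex v) ≤ k → ReachIn H x (Nat.find (hex v)) v := by
    intro v hv
    rcases Nat.find_spec (hex v) with h | h
    · omega
    · exact h
  have hmin : ∀ v i, ReachIn H x i v → Nat.find (hex v) ≤ i := fun v i h =>
    Nat.find_min' _ (Or.inr h)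
  have hlev : ∀ E ∈ H, ∀ u ∈ E, ∀ v ∈ E, Nat.find (hex u) ≤ Nat.find (hex v) + 1 := by
    intro E hE u hu v hv
    by_cases h : Nat.find (hex v) ≤ k
    · exact hmin u _ ⟨v, E, hE, hv, hu, hreach v h⟩
    · have := hle u
      omega
  have hpar : ∀ v, 0 < Nat.find (hex v) ∧ Nat.find (hex v) ≤ k → ∃ u, ∃ E ∈ H, u ∈ E ∧ v ∈ E ∧
      Nat.find (hex u) + 1 = Nat.find (hex v) := by
    rintro v ⟨h0, hk⟩
    have h := hreach v hk
    obtain ⟨j, hj⟩ : ∃ j, Nat.find (hex v) = j + 1 := ⟨_, (Nat.sub_add_cancel h0).symm⟩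
    rw [hj] at h
    obtain ⟨u, E, hE, hu, hv, hr⟩ := h
    have h1 := hlev E hE v hv u hu
    have h2 := hmin u j hr
    exact ⟨u, E, hE, hu, hv, by omega⟩
  have hV : Nonempty V := ⟨x⟩
  choose! par edge hE hp hv hl using hpar
  refine ⟨⟨fun v => Nat.find (hex v), par, edge, hlev, ?_, fun v h h' => hE v ⟨h, h'⟩,
    fun v h h' => hv v ⟨h, h'⟩, fun v h h' => hp v ⟨h, h'⟩, fun v h h' => hl v ⟨h, h'⟩⟩, ?_⟩
  · intro u v hu hv
    have h1 := hreach u (by omega)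
    have h2 := hreach v (by omega)
    rw [hu] at h1
    rw [hv] at h2
    exact Eq.trans h1 (Eq.symm h2)
  · exact Nat.le_zero.1 (hmin x 0 rfl)

theorem BergeTree.exists_mem_edge {V : Type*} {H : Finset (Finset V)} {k : ℕ} (T : BergeTree H k)
    {x v : V} (hx : T.lev x = 0) (hxH : ∃ E ∈ H, x ∈ E) (hv : T.lev v ≤ k) : ∃ E ∈ H, v ∈ E := by
  rcases Nat.eq_zero_or_pos (T.lev v) with h | h
  · exact T.root_unique v x h hx ▸ hxH
  · exact ⟨_, T.edge_mem v h hv, T.mem_edge v h hv⟩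

/-- If all degrees exceed `2 * k * q + 9 * k`, then the levels of a search tree grow by a factor
greater than `q`. -/
theorem BergeTree.pow_lt_card_level {V : Type*} [Fintype V] [DecidableEq V] {H : Finset (Finset V)}
    {k : ℕ} (T : BergeTree H k) (h3 : ∀ E ∈ H, E.card = 3)
    (hlin : ∀ E ∈ H, ∀ E' ∈ H, E ≠ E' → (E ∩ E').card ≤ 1)
    (hB : ¬ HasBergeCycle H (2 * k + 1)) {q : ℝ} (hq : 1 ≤ q)
    (hdeg : ∀ E ∈ H, ∀ v ∈ E, 2 * k * q + 9 * k < ((H.filter (fun E' => v ∈ E')).card : ℝ))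
    {x : V} (hx : T.lev x = 0) (hxH : ∃ E ∈ H, x ∈ E) {i : ℕ} (hik : i < k) :
    q ^ (i + 1) < (T.level (i + 1)).card := by
  have hstep : ∀ i < k, (i ≠ 0 → (T.level (i - 1)).card ≤ (T.level i).card) →
      0 < (T.level i).card → q * (T.level i).card < (T.level (i + 1)).card := by
    intro i hik hmono hpos
    have h1 := T.sum_degree_le h3 hlin hB hik hmono
    have h1' : ((∑ v ∈ T.level i, (H.filter (fun E => v ∈ E)).card : ℕ) : ℝ)
      ≤ 9 * k * (T.level i).card + 2 * k * (T.level (i + 1)).card := by exact_mod_cast h1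
    have h2 : ∑ v ∈ T.level i, (2 * k * q + 9 * k)
        < ∑ v ∈ T.level i, ((H.filter (fun E => v ∈ E)).card : ℝ) := by
      refine Finset.sum_lt_sum_of_nonempty (Finset.card_pos.1 hpos) fun v hv => ?_
      obtain ⟨E, hE, hvE⟩ := T.exists_mem_edge hx hxH (v := v)
        (by rw [T.mem_level.1 hv]; exact hik.le)
      exact hdeg E hE v hvE
    rw [Finset.sum_const, nsmul_eq_mul, ← Nat.cast_sum] at h2
    have hk : (0 : ℝ) < 2 * k := by
      have : (0 : ℝ) < k := by exact_mod_cast (Nat.zero_le i).trans_lt hik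
      linarith
    refine lt_of_mul_lt_mul_left ?_ hk.le
    linarith
  have hmain : ∀ i < k, (T.level i).card ≤ (T.level (i + 1)).card ∧ 0 < (T.level i).card ∧
      q ^ (i + 1) < (T.level (i + 1)).card := by
    intro i
    induction i with
    | zero =>
      intro h0
      have hpos : 0 < (T.level 0).card := Finset.card_pos.2 ⟨x, T.mem_level.2 hx⟩
      have hs := hstep 0 h0 (fun h => (h rfl).elim) hpos
      have hpos' : (1 : ℝ) ≤ (T.level 0).card := by exact_mod_cast hpos
      refine ⟨?_, hpos, ?_⟩
      · have : ((T.level 0).card : ℝ) ≤ (T.level (0 + 1)).card := by nlinarith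
        exact_mod_cast this
      · rw [zero_add, pow_one]
        rw [zero_add] at hs
        nlinarith
    | succ i ih =>
      intro hik
      obtain ⟨h1, h2, h4⟩ := ih (by omega)
      have hpos : 0 < (T.level (i + 1)).card := h2.trans_le h1
      have hs := hstep (i + 1) hik (fun _ => h1) hpos
      have hpos' : (0 : ℝ) ≤ (T.level (i + 1)).card := by positivity
      refine ⟨?_, hpos, ?_⟩
      · have : ((T.level (i + 1)).card : ℝ) ≤ (T.level (i + 1 + 1)).card := by nlinarith
        exact_mod_cast this
      · rw [pow_succ']
        exact (mul_lt_mul_of_pos_left h4 (by linarith)).trans hs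
  exact (hmain i hik).2.2

/-- Every 3-uniform linear hypergraph on `n` vertices with no Berge cycle of length
`2k+1` (`k ≥ 2`) has at most `2k·n^{1+1/k} + 9kn` hyperedges. -/
theorem stmt17 (n k : ℕ) (hk : 2 ≤ k) (H : Finset (Finset (Fin n)))
    (h3 : ∀ E ∈ H, E.card = 3)
    (hlin : ∀ E ∈ H, ∀ E' ∈ H, E ≠ E' → (E ∩ E').card ≤ 1)
    (hB : ¬ HasBergeCycle H (2 * k + 1)) :
    (H.card : ℝ) ≤ 2 * k * (n : ℝ) ^ ((1 : ℝ) + 1 / k) + 9 * k * n := by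
  rcases Nat.eq_zero_or_pos n with rfl | hn
  · have : H = ∅ := by
      refine Finset.eq_empty_of_forall_notMem fun E hE => ?_
      have h := h3 E hE
      rw [Subsingleton.elim E ∅] at h
      simp at h
    rw [this]
    simp only [Finset.card_empty, Nat.cast_zero]
    positivity
  have hn' : (1 : ℝ) ≤ n := by exact_mod_cast hn
  have hk0 : (k : ℝ) ≠ 0 := by exact_mod_cast (by omega : k ≠ 0)
  set q : ℝ := (n : ℝ) ^ ((1 : ℝ) / k) with hq
  have hq1 : 1 ≤ q := Real.one_le_rpow hn' (by positivity)
  have hqk : q ^ k = n := by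
    rw [hq, ← Real.rpow_natCast, ← Real.rpow_mul (by positivity), one_div_mul_cancel hk0,
      Real.rpow_one]
  rw [Real.rpow_add (by linarith), Real.rpow_one, ← hq]
  by_contra hcon
  push Not at hcon
  obtain ⟨G, hGH, ⟨E₀, hE₀⟩, hdeg⟩ := exists_subset_min_degree (fun E : Finset (Fin n) => E)
    (2 * k * q + 9 * k) (by positivity) Finset.univ H (fun _ _ => Finset.subset_univ _) (by
      rw [Finset.card_univ, Fintype.card_fin]
      linarith)
  obtain ⟨x, hx⟩ := Finset.card_pos.1 (by rw [h3 E₀ (hGH hE₀)]; norm_num : 0 < E₀.card)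
  obtain ⟨T, hT⟩ := exists_bergeTree G k x
  have hlt := T.pow_lt_card_level (fun E hE => h3 E (hGH hE))
    (fun E hE E' hE' => hlin E (hGH hE) E' (hGH hE'))
    (fun ⟨f, v, hf, hv, hfG, h⟩ => hB ⟨f, v, hf, hv, fun i => hGH (hfG i), h⟩)
    hq1 hdeg hT ⟨E₀, hE₀, hx⟩ (show k - 1 < k by omega)
  rw [Nat.sub_add_cancel (by omega), hqk, Nat.cast_lt] at hlt
  have := (T.level k).card_le_univ
  rw [Fintype.card_fin] at this
  omega
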